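/- Let (x_j)_{j≥1} be a decomposition of the identity on a Hilbert space H, and let T : H → H be a bounded linear operator which is not Hilbert–Schmidt. Then for every finite-dimensional subspace E ⊆ H, the supremum over all indices j with T x_j ≠ 0 of dist(T x_j / ‖T x_j‖, E) equals 1. -/

import Mathlib

open scoped RealInnerProductSpace

section

variable {H : Type*} [NormedAddCommGroup H] [InnerProductSpace ℝ H]

/-- Parseval's identity for a decomposition of the identity. -/
theorem hasSum_sq_inner_of_hasSum_smul {ι : Type*} {x : ι → H}
    (hx : ∀ v : H, HasSum (fun j => ⟪x j, v⟫ • x j) v) (v : H) :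
    HasSum (fun j => ⟪x j, v⟫ ^ 2) (‖v‖ ^ 2) := by
  have h := (innerSL ℝ v).hasSum (hx v)
  simp only [innerSL_apply_apply, inner_smul_right, real_inner_self_eq_norm_sq] at h
  refine h.congr_fun ?_
  intro j
  rw [real_inner_comm, sq]

/-- Parseval's identity for a Hilbert basis. -/
theorem HilbertBasis.hasSum_sq_inner {K : Type*} (b : HilbertBasis K ℝ H) (v : H) :
    HasSum (fun k => ⟪b k, v⟫ ^ 2) (‖v‖ ^ 2) :=
  hasSum_sq_inner_of_hasSum_smul
    (fun w => by simpa only [b.repr_apply_apply] using b.hasSum_repr w) v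

theorem ofReal_norm_sq_eq_tsum {ι : Type*} {x : ι → H}
    (hx : ∀ v : H, HasSum (fun j => ⟪x j, v⟫ ^ 2) (‖v‖ ^ 2)) (v : H) :
    ENNReal.ofReal (‖v‖ ^ 2) = ∑' j, ENNReal.ofReal (⟪x j, v⟫ ^ 2) := by
  rw [← (hx v).tsum_eq, ENNReal.ofReal_tsum_of_nonneg (fun _ => sq_nonneg _) (hx v).summable]

theorem tsum_ofReal_norm_sq_adjoint [CompleteSpace H] {ι κ : Type*} {x : ι → H} {y : κ → H}
    (hx : ∀ v : H, HasSum (fun j => ⟪x j, v⟫ ^ 2) (‖v‖ ^ 2))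
    (hy : ∀ v : H, HasSum (fun k => ⟪y k, v⟫ ^ 2) (‖v‖ ^ 2)) (A : H →L[ℝ] H) :
    ∑' j, ENNReal.ofReal (‖A (x j)‖ ^ 2) =
      ∑' k, ENNReal.ofReal (‖ContinuousLinearMap.adjoint A (y k)‖ ^ 2) := by
  simp_rw [ofReal_norm_sq_eq_tsum hy (A _),
    ofReal_norm_sq_eq_tsum hx (ContinuousLinearMap.adjoint A _)]
  rw [ENNReal.tsum_comm]
  simp_rw [ContinuousLinearMap.adjoint_inner_right, real_inner_comm]

theorem summable_iff_tsum_ofReal_ne_top {ι : Type*} {f : ι → ℝ} (hf : ∀ i, 0 ≤ f i) :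
    Summable f ↔ ∑' i, ENNReal.ofReal (f i) ≠ ⊤ := by
  refine ⟨Summable.tsum_ofReal_ne_top, fun h => ?_⟩
  simpa only [ENNReal.toReal_ofReal (hf _)] using ENNReal.summable_toReal h

/-- Square summability of the image of a Parseval family characterizes Hilbert–Schmidt
operators. -/
theorem summable_norm_sq_iff_of_parseval [CompleteSpace H] {ι K : Type*} {x : ι → H}
    (hx : ∀ v : H, HasSum (fun j => ⟪x j, v⟫ ^ 2) (‖v‖ ^ 2)) (b : HilbertBasis K ℝ H)
    (T : H →L[ℝ] H) :
    Summable (fun j => ‖T (x j)‖ ^ 2) ↔ Summable (fun k => ‖T (b k)‖ ^ 2) := by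
  rw [summable_iff_tsum_ofReal_ne_top (fun _ => sq_nonneg _),
    summable_iff_tsum_ofReal_ne_top (fun _ => sq_nonneg _),
    tsum_ofReal_norm_sq_adjoint hx b.hasSum_sq_inner,
    tsum_ofReal_norm_sq_adjoint b.hasSum_sq_inner b.hasSum_sq_inner,
    ContinuousLinearMap.adjoint_adjoint]

theorem summable_norm_sq_starProjection [CompleteSpace H] {ι : Type*} {x : ι → H}
    (hx : ∀ v : H, HasSum (fun j => ⟪x j, v⟫ ^ 2) (‖v‖ ^ 2)) (T : H →L[ℝ] H)
    (E : Submodule ℝ H) [FiniteDimensional ℝ E] :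
    Summable (fun j => ‖E.starProjection (T (x j))‖ ^ 2) := by
  let e := stdOrthonormalBasis ℝ E
  have key (j : ι) : ‖E.starProjection (T (x j))‖ ^ 2 =
      ∑ i, ⟪x j, ContinuousLinearMap.adjoint T (e i : H)⟫ ^ 2 := by
    rw [E.starProjection_apply, ← Submodule.coe_norm, ← e.sum_sq_norm_inner_right]
    refine Finset.sum_congr rfl fun i _ => ?_
    rw [Real.norm_eq_abs, sq_abs, Submodule.coe_inner, ← E.starProjection_apply,
      ← E.inner_starProjection_left_eq_right, E.starProjection_eq_self_iff.2 (e i).2,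
      ContinuousLinearMap.adjoint_inner_right, real_inner_comm]
  simp_rw [key]
  exact summable_sum fun i _ => (hx _).summable

theorem infDist_eq_norm_sub_starProjection (E : Submodule ℝ H) [E.HasOrthogonalProjection]
    (v : H) : Metric.infDist v (E : Set H) = ‖v - E.starProjection v‖ := by
  rw [E.starProjection_minimal, Metric.infDist_eq_iInf]
  simp_rw [dist_eq_norm]
  rfl

theorem sq_norm_le_of_infDist_normalized_le (E : Submodule ℝ H) [E.HasOrthogonalProjection]
    {v : H} (hv : v ≠ 0) {s : ℝ} (h : Metric.infDist (‖v‖⁻¹ • v) (E : Set H) ≤ s) :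
    (1 - s ^ 2) * ‖v‖ ^ 2 ≤ ‖E.starProjection v‖ ^ 2 := by
  have hv' : 0 < ‖v‖ := norm_pos_iff.2 hv
  rw [infDist_eq_norm_sub_starProjection, map_smul, ← smul_sub, norm_smul, norm_inv, norm_norm,
    inv_mul_le_iff₀ hv'] at h
  have hpyth := E.norm_sq_eq_add_norm_sq_starProjection v
  rw [E.starProjection_orthogonal_val] at hpyth
  have hsq := pow_le_pow_left₀ (norm_nonneg _) h 2
  rw [mul_pow] at hsq
  linarith

end

/-- Let `(x j)` be a decomposition of the identity on a Hilbert space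
`H`, and let `T` be a bounded operator which is not Hilbert–Schmidt (with respect to an
orthonormal basis `b`). Then for every finite-dimensional subspace `E ⊆ H`, the supremum
over all `j` with `T x j ≠ 0` of `dist (T x j / ‖T x j‖, E)` equals `1`. -/
theorem sup_dist_normalized_image_eq_one
    {H : Type*} [NormedAddCommGroup H] [InnerProductSpace ℝ H] [CompleteSpace H]
    (x : ℕ → H)
    (hx : ∀ v : H, HasSum (fun j => ⟪x j, v⟫ • x j) v)
    (T : H →L[ℝ] H) {K : Type*} (b : HilbertBasis K ℝ H)
    (hT : ¬ Summable (fun k => ‖T (b k)‖ ^ 2))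
    (E : Submodule ℝ H) (hE : FiniteDimensional ℝ E) :
    IsLUB {d : ℝ | ∃ j : ℕ, T (x j) ≠ 0 ∧
      d = Metric.infDist (‖T (x j)‖⁻¹ • T (x j)) (E : Set H)} 1 := by
  have hparseval := hasSum_sq_inner_of_hasSum_smul hx
  refine ⟨?_, fun u hu => ?_⟩
  · rintro _ ⟨j, hj, rfl⟩
    refine (Metric.infDist_le_dist_of_mem E.zero_mem).trans ?_
    rw [dist_zero_right, norm_smul, norm_inv, norm_norm, inv_mul_cancel₀ (norm_ne_zero_iff.2 hj)]
  · by_contra! hu1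
    refine hT ((summable_norm_sq_iff_of_parseval hparseval b T).1 ?_)
    have hs0 : 0 ≤ max u 0 := le_max_right _ _
    have hs1 : max u 0 < 1 := max_lt hu1 one_pos
    have hpos : 0 < 1 - max u 0 ^ 2 := by nlinarith
    rw [← summable_mul_left_iff hpos.ne']
    refine (summable_norm_sq_starProjection hparseval T E).of_nonneg_of_le
      (fun j => by positivity) fun j => ?_
    by_cases hj : T (x j) = 0
    · simp [hj]
    · exact sq_norm_le_of_infDist_normalized_le E hj ((hu ⟨j, hj, rfl⟩).trans (le_max_left _ _))
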